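/- arXiv:1208.0985 — 2 statements merged into one kernel-verified Lean document; each statement's English description precedes it below -/
import Mathlib

section
/- Let f be a Brouwer homeomorphism and B a critical disk, i.e. a topological closed disk whose interior is free (f(Int B) ∩ Int B = ∅) but with f(B) ∩ B ≠ ∅. Then f^n(B) ∩ B ≠ ∅ if and only if n ∈ {-1, 0, 1}. -/
def OrientationPreserving {X : Type*} [TopologicalSpace X] (f : X ≃ₜ X) : Prop :=
  ∃ F : ℝ → X ≃ₜ X, (Continuous fun p : ℝ × X => F p.1 p.2) ∧
    F 0 = Homeomorph.refl X ∧ F 1 = f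

open Set Metric Topology unitInterval Function

/-- Homotopy lifting through the complex exponential. Points of `A` with the same initial value
and the same track have the same final value. -/
theorem exists_continuous_log_of_homotopy {A : Type*} [TopologicalSpace A] (H : I → A → ℂ)
    (hH : Continuous fun q : I × A => H q.1 q.2) (hne : ∀ t a, H t a ≠ 0)
    (g : A → ℂ) (hg : Continuous g) (h0 : ∀ a, H 0 a = Complex.exp (g a)) :
    ∃ M : A → ℂ, Continuous M ∧ (∀ a, Complex.exp (M a) = H 1 a) ∧
      ∀ a b, g a = g b → (∀ t, H t a = H t b) → M a = M b := by
  let H' : C(I × A, {z : ℂ // z ≠ 0}) := ⟨fun q => ⟨H q.1 q.2, hne _ _⟩, by fun_prop⟩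
  have hH0 : ∀ a, H' (0, a) = (⟨_, (g a).exp_ne_zero⟩ : {z : ℂ // z ≠ 0}) :=
    fun a => Subtype.ext (h0 a)
  let L := Complex.isCoveringMap_exp.liftHomotopy H' ⟨g, hg⟩ hH0
  have hL : ∀ q, Complex.exp (L q) = H q.1 q.2 := fun q =>
    congrArg Subtype.val (congrFun (Complex.isCoveringMap_exp.liftHomotopy_lifts H' ⟨g, hg⟩ hH0) q)
  refine ⟨fun a => L (1, a), by fun_prop, fun a => hL _, fun a b hab ht => ?_⟩
  have h := Complex.isCoveringMap_exp.eq_of_comp_eq (g₁ := fun t : I => L (t, a))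
    (g₂ := fun t : I => L (t, b)) (by fun_prop) (by fun_prop)
    (funext fun t => Subtype.ext (by simp [hL, ht])) 0
    (by
      have e := Complex.isCoveringMap_exp.liftHomotopy_zero H' ⟨g, hg⟩ hH0
      exact (e a).trans (hab.trans (e b).symm))
  exact congrFun h 1

theorem eq_of_exp_eq_one {A : Type*} [TopologicalSpace A] [PreconnectedSpace A] {g : A → ℂ}
    (hg : Continuous g) (h : ∀ a, Complex.exp (g a) = 1) (a b : A) : g a = g b :=
  Complex.isCoveringMap_exp.const_of_comp hg
    (fun a b => Subtype.ext ((h a).trans (h b).symm)) a b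

theorem not_exists_continuous_odd_exp :
    ¬ ∃ M : sphere (0 : ℂ) 1 → ℂ, Continuous M ∧
      ∀ u, Complex.exp (M (-u)) = -Complex.exp (M u) := by
  rintro ⟨M, hM, hodd⟩
  have : PreconnectedSpace (sphere (0 : ℂ) 1) := Subtype.preconnectedSpace
    (isPreconnected_sphere (by rw [Complex.rank_real_complex]; norm_num) _ _)
  let u : sphere (0 : ℂ) 1 := ⟨1, by simp⟩
  have h := eq_of_exp_eq_one (g := fun u => M (-u) - M u - Real.pi * Complex.I) (by fun_prop)
    (fun v => by
      rw [Complex.exp_sub, Complex.exp_sub, hodd, Complex.exp_pi_mul_I]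
      field_simp) u (-u)
  simp only [neg_neg] at h
  have h1 : M (-u) = M u := by linear_combination h / 2
  have h2 := hodd u
  rw [h1] at h2
  exact Complex.exp_ne_zero (M u) (by linear_combination h2 / 2)

/-- Invariance of domain in the plane. -/
theorem image_closedBall_mem_nhds {φ : ℂ → ℂ} {p : ℂ} {r : ℝ} (hr : 0 < r)
    (hc : ContinuousOn φ (closedBall p r)) (hi : InjOn φ (closedBall p r)) :
    φ '' closedBall p r ∈ 𝓝 (φ p) := by
  by_contra hnot
  have hmem : ∀ (t : I) (u : sphere (0 : ℂ) 1), p + (t : ℝ) * r * u ∈ closedBall p r := by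
    intro t u
    have hu : ‖(u : ℂ)‖ = 1 := by simp
    simp only [mem_closedBall, dist_self_add_left, norm_mul, Complex.norm_real, hu,
      Real.norm_eq_abs, abs_of_nonneg t.2.1, abs_of_pos hr, mul_one]
    nlinarith [t.2.2]
  have hmem' : ∀ (t : I) (u : sphere (0 : ℂ) 1), p - (t : ℝ) * r * u ∈ closedBall p r := by
    intro t u
    simpa [sub_eq_add_neg] using hmem t (-u)
  have hmem1 : ∀ u : sphere (0 : ℂ) 1, p + r * u ∈ closedBall p r := fun u => by
    simpa using hmem 1 u
  have hp : p ∈ closedBall p r := mem_closedBall_self hr.le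
  have hu0 : ∀ u : sphere (0 : ℂ) 1, (u : ℂ) ≠ 0 := fun u => by
    rw [← norm_ne_zero_iff]; simp
  have hr0 : (r : ℂ) ≠ 0 := by exact_mod_cast hr.ne'
  have hcs : Continuous fun u : sphere (0 : ℂ) 1 => φ (p + r * u) :=
    hc.comp_continuous (by fun_prop) hmem1
  have hcp : Continuous fun q : I × sphere (0 : ℂ) 1 => φ (p + (q.1 : ℝ) * r * q.2) :=
    hc.comp_continuous (f := fun q : I × sphere (0 : ℂ) 1 => p + ((q.1 : ℝ) : ℂ) * r * q.2)
      (by fun_prop) fun q => hmem q.1 q.2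
  have hcm : Continuous fun q : I × sphere (0 : ℂ) 1 => φ (p - (q.1 : ℝ) * r * q.2) :=
    hc.comp_continuous (f := fun q : I × sphere (0 : ℂ) 1 => p - ((q.1 : ℝ) : ℂ) * r * q.2)
      (by fun_prop) fun q => hmem' q.1 q.2
  obtain ⟨δ, hδ, hball⟩ : ∃ δ > 0, ∀ u : sphere (0 : ℂ) 1, δ ≤ ‖φ (p + r * u) - φ p‖ := by
    have hcomp := (isCompact_range hcs).isClosed.isOpen_compl
    have : φ p ∈ (range fun u : sphere (0 : ℂ) 1 => φ (p + r * u))ᶜ := by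
      rintro ⟨u, hu⟩
      have := hi (hmem1 u) hp hu
      simp [hr0, hu0 u] at this
    obtain ⟨δ, hδ, h⟩ := Metric.isOpen_iff.1 hcomp _ this
    refine ⟨δ, hδ, fun u => not_lt.1 fun hlt => h (?_ : φ (p + r * u) ∈ _) ⟨u, rfl⟩⟩
    rwa [mem_ball, dist_eq_norm]
  obtain ⟨c, hcδ, hcK⟩ : ∃ c ∈ ball (φ p) δ, c ∉ φ '' closedBall p r := by
    by_contra! hcon
    exact hnot (Filter.mem_of_superset (ball_mem_nhds _ hδ) hcon)
  have hcδ' : ‖φ p - c‖ < δ := by rwa [mem_ball', dist_eq_norm] at hcδ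
  obtain ⟨M₁, hM₁, hexp₁, -⟩ := exists_continuous_log_of_homotopy
    (fun (t : I) (u : sphere (0 : ℂ) 1) => φ (p + (t : ℝ) * r * u) - c)
    (hcp.sub continuous_const)
    (fun t u h => hcK ⟨p + (t : ℝ) * r * u, hmem t u, sub_eq_zero.1 h⟩)
    (fun _ => Complex.log (φ p - c)) continuous_const
    (fun u => by
      rw [Complex.exp_log (fun h => hcK ⟨p, hp, sub_eq_zero.1 h⟩)]
      simp)
  obtain ⟨M₂, hM₂, hexp₂, -⟩ := exists_continuous_log_of_homotopy
    (fun (t : I) (u : sphere (0 : ℂ) 1) => φ (p + r * u) - (c + (t : ℝ) * (φ p - c)))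
    ((hcs.comp continuous_snd).sub (by fun_prop))
    (fun t u h => by
      have h1 : φ (p + r * u) - φ p = -((1 - t : ℝ) * (φ p - c)) := by
        push_cast
        linear_combination h
      have h2 := hball u
      rw [h1, norm_neg, norm_mul, Complex.norm_real, Real.norm_eq_abs,
        abs_of_nonneg (by linarith [t.2.2])] at h2
      nlinarith [t.2.1, norm_nonneg (φ p - c)])
    M₁ hM₁ (fun u => by simp [hexp₁])
  obtain ⟨M₃, hM₃, hexp₃, -⟩ := exists_continuous_log_of_homotopy
    (fun (t : I) (u : sphere (0 : ℂ) 1) => φ (p + r * u) - φ (p - (t : ℝ) * r * u))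
    ((hcs.comp continuous_snd).sub hcm)
    (fun t u h => by
      have h1 := hi (hmem1 u) (hmem' t u) (sub_eq_zero.1 h)
      have h2 : (r * u : ℂ) * ((1 + t : ℝ) : ℂ) = 0 := by
        push_cast
        linear_combination h1
      have h3 : (1 + t : ℝ) ≠ 0 := by linarith [t.2.1]
      simp only [mul_eq_zero, hr0, hu0 u, Complex.ofReal_eq_zero, h3, or_self] at h2)
    M₂ hM₂ (fun u => by simp [hexp₂])
  refine not_exists_continuous_odd_exp ⟨M₃, hM₃, fun u => ?_⟩
  rw [hexp₃, hexp₃]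
  simp [sub_eq_add_neg]

/-- A fixed point free homeomorphism of the plane isotopic to the identity has no point of
period two. -/
theorem OrientationPreserving.no_period_two {f : ℂ ≃ₜ ℂ} (hor : OrientationPreserving f)
    (hfree : ∀ x, f x ≠ x) (x : ℂ) : f (f x) ≠ x := by
  intro hx
  obtain ⟨F, hF, hF0, hF1⟩ := hor
  have hfc := f.continuous
  obtain ⟨L, hL, hexpL, -⟩ := exists_continuous_log_of_homotopy
    (fun (t : I) (z : ℂ) => f ((t : ℝ) * z) - (t : ℝ) * z) (by fun_prop)
    (fun t z h => hfree _ (sub_eq_zero.1 h)) (fun _ => Complex.log (f 0)) continuous_const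
    (fun z => by rw [Complex.exp_log (hfree 0)]; simp)
  obtain ⟨M, hM, hexpM, hsymm⟩ := exists_continuous_log_of_homotopy
    (fun (t : I) (z : ℂ) => (F t (f z) - F t z) / (f z - z))
    (by
      have h1 : Continuous fun q : I × ℂ => F q.1 (f q.2) :=
        hF.comp (f := fun q : I × ℂ => ((q.1 : ℝ), f q.2)) (by fun_prop)
      have h2 : Continuous fun q : I × ℂ => F q.1 q.2 :=
        hF.comp (f := fun q : I × ℂ => ((q.1 : ℝ), q.2)) (by fun_prop)
      exact (h1.sub h2).div (by fun_prop) fun q => sub_ne_zero.2 (hfree _))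
    (fun t z => div_ne_zero (sub_ne_zero.2 fun h => hfree _ ((F t).injective h))
      (sub_ne_zero.2 (hfree _)))
    (fun _ => 0) continuous_const
    (fun z => by simp [hF0, sub_ne_zero.2 (hfree z)])
  have hconst := eq_of_exp_eq_one (g := fun z => L (f z) - L z - M z) (by fun_prop)
    (fun z => by
      have h1 := sub_ne_zero.2 (hfree z)
      have h2 := sub_ne_zero.2 (hfree (f z))
      rw [Complex.exp_sub, Complex.exp_sub, hexpL, hexpL, hexpM]
      simp only [Icc.coe_one, Complex.ofReal_one, one_mul, hF1]
      field_simp) x (f x)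
  have hMs : M (f x) = M x := hsymm _ _ rfl fun t => by
    rw [hx, ← neg_sub (F t (f x)), ← neg_sub (f x), neg_div_neg_eq]
  rw [hx, hMs] at hconst
  have h1 : L (f x) = L x := by linear_combination hconst / 2
  have h2 := hexpL (f x)
  rw [h1, hexpL x] at h2
  simp only [Icc.coe_one, Complex.ofReal_one, one_mul, hx] at h2
  exact hfree x (by linear_combination h2 / 2)

theorem OrientationPreserving.trans {X : Type*} [TopologicalSpace X] {f g : X ≃ₜ X}
    (hf : OrientationPreserving f) (hg : OrientationPreserving g) :
    OrientationPreserving (f.trans g) := by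
  obtain ⟨F, hF, hF0, hF1⟩ := hf
  obtain ⟨G, hG, hG0, hG1⟩ := hg
  exact ⟨fun t => (F t).trans (G t), hG.comp (continuous_fst.prodMk hF), by
    simp only [hF0, hG0]; rfl, by simp only [hF1, hG1]⟩

/-- A push of the plane, supported in a ball, carrying the centre to a given point of the ball. -/
theorem exists_orientationPreserving_ball {a b : ℂ} {r : ℝ} (hb : b ∈ ball a r) :
    ∃ h : ℂ ≃ₜ ℂ, OrientationPreserving h ∧ (∀ x ∉ ball a r, h x = x) ∧ h a = b := by
  have hba : ‖b - a‖ < r := by rwa [mem_ball, dist_eq_norm] at hb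
  have hr : 0 < r := (norm_nonneg _).trans_lt hba
  let β : ℝ → ℂ → ℝ := fun t x => max 0 (min t 1) * max 0 (1 - dist x a / r)
  let T : ℝ → ℂ → ℂ := fun t x => x + β t x * (b - a)
  let k : NNReal := ⟨‖b - a‖ / r, by positivity⟩
  have hk : k < 1 := by
    rw [← NNReal.coe_lt_coe]
    exact (div_lt_one hr).2 hba
  have hβ : ∀ t x y, |β t x - β t y| ≤ dist x y / r := by
    intro t x y
    have h0 : |max 0 (min t 1)| ≤ 1 := by
      rw [abs_of_nonneg (le_max_left _ _)]
      exact max_le zero_le_one (min_le_right _ _)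
    have h1 : |max 0 (1 - dist x a / r) - max 0 (1 - dist y a / r)| ≤ dist x y / r := by
      rw [max_comm 0, max_comm 0]
      refine (abs_max_sub_max_le_abs _ _ 0).trans ?_
      rw [show (1 - dist x a / r) - (1 - dist y a / r) = (dist y a - dist x a) / r by ring,
        abs_div, abs_of_pos hr]
      gcongr
      rw [dist_comm x y]
      exact abs_dist_sub_le _ _ _
    calc |β t x - β t y|
        = |max 0 (min t 1)| * |max 0 (1 - dist x a / r) - max 0 (1 - dist y a / r)| := by
          rw [← abs_mul, mul_sub]
      _ ≤ 1 * (dist x y / r) := by gcongr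
      _ = dist x y / r := one_mul _
  have happ : ∀ t, ApproximatesLinearOn (T t)
      (ContinuousLinearEquiv.refl ℝ ℂ : ℂ →L[ℝ] ℂ) univ k := by
    intro t x _ y _
    have : T t x - T t y - (x - y) = ((β t x - β t y : ℝ) : ℂ) * (b - a) := by
      simp only [T]
      push_cast
      ring
    change ‖T t x - T t y - (x - y)‖ ≤ ‖b - a‖ / r * ‖x - y‖
    rw [this, norm_mul, Complex.norm_real, Real.norm_eq_abs]
    calc |β t x - β t y| * ‖b - a‖ ≤ dist x y / r * ‖b - a‖ := by gcongr; exact hβ t x y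
      _ = ‖b - a‖ / r * ‖x - y‖ := by rw [dist_eq_norm]; ring
  have hN : Subsingleton ℂ ∨
      k < ‖((ContinuousLinearEquiv.refl ℝ ℂ).symm : ℂ →L[ℝ] ℂ)‖₊⁻¹ := by
    right
    have : ‖((ContinuousLinearEquiv.refl ℝ ℂ).symm : ℂ →L[ℝ] ℂ)‖₊ = 1 := by
      ext
      exact ContinuousLinearMap.norm_id
    rwa [this, inv_one]
  let F : ℝ → ℂ ≃ₜ ℂ := fun t => (happ t).toHomeomorph (T t) hN
  have hFT : ∀ t x, F t x = T t x := fun _ _ => rfl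
  refine ⟨F 1, ⟨F, ?_, ?_, rfl⟩, fun x hx => ?_, ?_⟩
  · simp only [hFT, T, β]
    fun_prop
  · ext x
    simp [hFT, T, β]
  · have : 1 ≤ dist x a / r := (one_le_div hr).2 (not_lt.1 hx)
    simp [hFT, T, β, max_eq_left (sub_nonpos.2 this)]
  · simp [hFT, T, β]

/-- The orientation preserving homeomorphisms supported in a connected open set act transitively
on it. -/
theorem exists_orientationPreserving_of_isPreconnected {V : Set ℂ} (hV : IsOpen V)
    (hVc : IsPreconnected V) {a b : ℂ} (ha : a ∈ V) (hb : b ∈ V) :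
    ∃ h : ℂ ≃ₜ ℂ, OrientationPreserving h ∧ (∀ x ∉ V, h x = x) ∧ h a = b := by
  refine hVc.induction₂' (fun a b => ∃ h : ℂ ≃ₜ ℂ, OrientationPreserving h ∧
    (∀ x ∉ V, h x = x) ∧ h a = b) (fun x hx => ?_) ?_ ha hb
  · obtain ⟨r, hr, hrV⟩ := Metric.isOpen_iff.1 hV x hx
    filter_upwards [nhdsWithin_le_nhds (ball_mem_nhds x (half_pos hr))] with y hy
    obtain ⟨h, ho, hs, hxy⟩ := exists_orientationPreserving_ball
      (ball_subset_ball (half_le_self hr.le) hy)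
    obtain ⟨h', ho', hs', hyx⟩ := exists_orientationPreserving_ball (mem_ball_comm.1 hy)
    have hsub : ball y (r / 2) ⊆ ball x r := ball_subset_ball' (by
      rw [mem_ball] at hy
      linarith)
    exact ⟨⟨h, ho, fun z hz => hs z fun hz' => hz (hrV hz'), hxy⟩,
      ⟨h', ho', fun z hz => hs' z fun hz' => hz (hrV (hsub hz')), hyx⟩⟩
  · rintro x y z - - - ⟨h, ho, hs, hxy⟩ ⟨h', ho', hs', hyz⟩
    exact ⟨h.trans h', ho.trans ho', fun w hw => by simp [hs w hw, hs' w hw], by simp [hxy, hyz]⟩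

/-- Composing with a homeomorphism supported in a free set creates no fixed point. -/
theorem trans_apply_ne_of_free {f h : ℂ ≃ₜ ℂ} (hfree : ∀ x, f x ≠ x) {V : Set ℂ}
    (hV : ∀ x ∈ V, f x ∉ V) (hs : ∀ x ∉ V, h x = x) (x : ℂ) : f.trans h x ≠ x := by
  intro hx
  rw [Homeomorph.trans_apply] at hx
  by_cases hfx : f x ∈ V
  · by_cases hxV : x ∈ V
    · exact hV x hxV hfx
    · exact hxV (h.injective (hx.trans (hs x hxV).symm) ▸ hfx)
  · exact hfree x ((hs _ hfx).symm.trans hx)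

theorem iterate_trans_eq_of_notMem {f h : ℂ ≃ₜ ℂ} {V : Set ℂ} (hs : ∀ x ∉ V, h x = x) {x : ℂ}
    {n : ℕ} (hx : ∀ m, 1 ≤ m → m ≤ n → f^[m] x ∉ V) : (f.trans h)^[n] x = f^[n] x := by
  induction n with
  | zero => rfl
  | succ n ih =>
    rw [iterate_succ_apply', ih fun m h1 h2 => hx m h1 (h2.trans n.le_succ),
      Homeomorph.trans_apply, ← iterate_succ_apply' f]
    exact hs _ (hx _ (Nat.le_add_left 1 n) le_rfl)

/-- A connected compact set with a given open neighbourhood has a connected one inside. -/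
theorem IsPreconnected.exists_isOpen_isPreconnected_between {A W : Set ℂ} (hA : IsPreconnected A)
    (hW : IsOpen W) (hAW : A ⊆ W) : ∃ V, IsOpen V ∧ IsPreconnected V ∧ A ⊆ V ∧ V ⊆ W := by
  rcases A.eq_empty_or_nonempty with rfl | ⟨a, ha⟩
  · exact ⟨∅, isOpen_empty, isPreconnected_empty, subset_rfl, empty_subset _⟩
  · exact ⟨_root_.connectedComponentIn W a, hW.connectedComponentIn, isPreconnected_connectedComponentIn,
      hA.subset_connectedComponentIn ha hAW, connectedComponentIn_subset _ _⟩

theorem IsCompact.exists_isOpen_disjoint_image {A B : Set ℂ} (hA : IsCompact A) (hB : IsCompact B)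
    {g : ℂ → ℂ} (hg : Continuous g) (h : ∀ x ∈ A, g x ∉ B) :
    ∃ U W, IsOpen U ∧ IsOpen W ∧ A ⊆ U ∧ B ⊆ W ∧ ∀ x ∈ U, g x ∉ W := by
  obtain ⟨O, W, hO, hW, hAO, hBW, hd⟩ := SeparatedNhds.of_isCompact_isCompact (hA.image hg) hB
    (by rw [Set.disjoint_left]; rintro _ ⟨x, hx, rfl⟩; exact h x hx)
  exact ⟨g ⁻¹' O, W, hO.preimage hg, hW, fun x hx => hAO (mem_image_of_mem g hx), hBW,
    fun x hx hx' => Set.disjoint_left.1 hd hx hx'⟩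

theorem IsPreconnected.exists_free_nhds {A W : Set ℂ} (hA : IsPreconnected A) (hAc : IsCompact A)
    {f : ℂ → ℂ} (hf : Continuous f) (h : ∀ x ∈ A, f x ∉ A) (hW : IsOpen W) (hAW : A ⊆ W) :
    ∃ V, IsOpen V ∧ IsPreconnected V ∧ A ⊆ V ∧ V ⊆ W ∧ ∀ x ∈ V, f x ∉ V := by
  obtain ⟨U, U', hU, hU', hAU, hAU', hd⟩ := hAc.exists_isOpen_disjoint_image hAc hf h
  obtain ⟨V, hV, hVc, hAV, hVW⟩ := hA.exists_isOpen_isPreconnected_between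
    ((hU.inter hU').inter hW) (subset_inter (subset_inter hAU hAU') hAW)
  exact ⟨V, hV, hVc, hAV, fun x hx => (hVW hx).2,
    fun x hx hfx => hd x (hVW hx).1.1 (hVW hfx).1.2⟩

/-- No fixed point free homeomorphism of the plane isotopic to the identity has an `n`-periodic
point. -/
def NoPeriod (n : ℕ) : Prop :=
  ∀ f : ℂ ≃ₜ ℂ, OrientationPreserving f → (∀ x, f x ≠ x) → ∀ x, f^[n] x ≠ x

/-- The free disk lemma at time `n`: a free connected open set does not meet its `n`-th image. -/
def NoFreeReturn (n : ℕ) : Prop :=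
  ∀ f : ℂ ≃ₜ ℂ, OrientationPreserving f → (∀ x, f x ≠ x) → ∀ V : Set ℂ, IsOpen V →
    IsPreconnected V → (∀ x ∈ V, f x ∉ V) → ∀ x ∈ V, f^[n] x ∉ V

/-- A free return at time `n` can be closed up to a periodic orbit. -/
theorem NoPeriod.noFreeReturn {n : ℕ} (hn : 1 ≤ n) (hP : NoPeriod n)
    (hR : ∀ m, 1 ≤ m → m < n → NoFreeReturn m) : NoFreeReturn n := by
  intro f hor hfree V hV hVc hVf x hx hnx
  obtain ⟨h, ho, hs, hb⟩ := exists_orientationPreserving_of_isPreconnected hV hVc hnx hx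
  obtain ⟨k, rfl⟩ : ∃ k, n = k + 1 := ⟨n - 1, by omega⟩
  refine hP (f.trans h) (hor.trans ho) (trans_apply_ne_of_free hfree hVf hs) x ?_
  rw [iterate_succ_apply', iterate_trans_eq_of_notMem hs fun m h1 h2 =>
    hR m h1 (by omega) f hor hfree V hV hVc hVf x hx, Homeomorph.trans_apply,
    ← iterate_succ_apply' f, hb]

/-- If `U` is open and free then no point of `U` is mapped to the closure of `U`, nor conversely. -/
theorem free_closure {f : ℂ ≃ₜ ℂ} {U : Set ℂ} (hU : IsOpen U) (hf : ∀ x ∈ U, f x ∉ U) :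
    (∀ x ∈ U, f x ∉ closure U) ∧ ∀ x ∈ closure U, f x ∉ U := by
  constructor
  · intro x hx hfx
    obtain ⟨_, ⟨y, hy, rfl⟩, hyU⟩ := mem_closure_iff.1 hfx _ (f.isOpenMap _ hU) ⟨x, hx, rfl⟩
    exact hf y hy hyU
  · intro x hx hfx
    obtain ⟨y, hy, hyU⟩ := mem_closure_iff.1 hx _ (hU.preimage f.continuous) hfx
    exact hf y hyU hy

/-- Around every point there is a ball with free interior whose closure is not free. -/
theorem exists_critical_ball {f : ℂ ≃ₜ ℂ} (hfree : ∀ x, f x ≠ x) (x : ℂ) :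
    ∃ r > 0, ∃ z ∈ closedBall x r, f z ∈ closedBall x r ∧ ∀ y ∈ ball x r, f y ∉ ball x r := by
  let ρ : ℂ → ℝ := fun y => max (dist y x) (dist (f y) x)
  have hρ : Continuous ρ := by
    have := f.continuous
    fun_prop
  obtain ⟨z, hz⟩ := hρ.exists_forall_le (Filter.tendsto_atTop_mono (fun y => le_max_left _ _)
    (tendsto_dist_right_cocompact_atTop x))
  refine ⟨ρ z, ?_, z, le_max_left (dist z x) _, le_max_right (dist z x) (dist (f z) x), fun y hy hfy =>
    (hz y).not_gt (max_lt hy hfy)⟩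
  refine (dist_nonneg.trans (le_max_left _ _)).lt_of_ne fun h0 => hfree z ?_
  have h1 : dist z x ≤ 0 := (le_max_left (dist z x) (dist (f z) x)).trans_eq h0.symm
  have h2 : dist (f z) x ≤ 0 := (le_max_right (dist z x) (dist (f z) x)).trans_eq h0.symm
  rw [dist_le_zero.1 h1] at h2 ⊢
  exact dist_le_zero.1 h2

theorem segment_subset_insert_ball {x w : ℂ} {r : ℝ} (hr : 0 < r) (hw : w ∈ closedBall x r) :
    segment ℝ x w ⊆ insert w (ball x r) := by
  intro y hy
  rw [← insert_endpoints_openSegment] at hy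
  rcases hy with rfl | rfl | hy
  · exact Or.inr (mem_ball_self hr)
  · exact Or.inl rfl
  · by_cases hxw : x = w
    · subst hxw
      rw [openSegment_same] at hy
      exact Or.inl hy
    · refine Or.inr ?_
      rw [← interior_closedBall x hr.ne']
      exact (strictConvex_closedBall ℝ x r).openSegment_subset (mem_closedBall_self hr.le) hw hxw hy

/-- Using a critical ball at an `n`-periodic point, the dynamics can be modified to produce a free
return at time `n - 1`. -/
theorem noPeriod_of_noFreeReturn {n : ℕ} (hn : 3 ≤ n)
    (hR : ∀ m, 1 ≤ m → m < n → NoFreeReturn m) : NoPeriod n := by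
  intro f hor hfree x hx
  obtain ⟨r, hr, z, hz, hfz, hU⟩ := exists_critical_ball hfree x
  have hUc : closure (ball x r) = closedBall x r := closure_ball x hr.ne'
  obtain ⟨hcl₁, hcl₂⟩ := free_closure isOpen_ball hU
  rw [hUc] at hcl₁ hcl₂
  have hfc := f.continuous
  have hfreeSeg : ∀ w ∈ closedBall x r, ∀ a ∈ segment ℝ x w, f a ∉ segment ℝ x w := by
    intro w hw a ha hfa
    have hsub : insert w (ball x r) ⊆ closedBall x r := insert_subset hw ball_subset_closedBall
    rcases segment_subset_insert_ball hr hw ha with rfl | ha'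
    · rcases segment_subset_insert_ball hr hw hfa with h | h
      · exact hfree _ h
      · exact hcl₂ _ hw h
    · exact hcl₁ a ha' (hsub (segment_subset_insert_ball hr hw hfa))
  have hsegc : ∀ w, IsCompact (segment ℝ x w) := fun w => by
    rw [segment_eq_image_lineMap]
    exact isCompact_Icc.image (by fun_prop)
  have hsegp : ∀ w, IsPreconnected (segment ℝ x w) := fun w => (convex_segment x w).isPreconnected
  have hdisj : ∀ a ∈ segment ℝ x z, f (f a) ∉ segment ℝ x (f z) := by
    intro a ha hffa
    rcases segment_subset_insert_ball hr hz ha with rfl | ha'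
    · exact hfreeSeg _ hfz _ (right_mem_segment ℝ _ _) hffa
    · rcases segment_subset_insert_ball hr hfz hffa with h | h
      · exact hcl₁ a ha' (f.injective h ▸ hz)
      · exact hR 2 (by norm_num) (by omega) f hor hfree _ isOpen_ball
          (convex_ball x r).isPreconnected hU a ha' h
  obtain ⟨O', O, hO', hO, hAO', hAO, hOO⟩ := (hsegc z).exists_isOpen_disjoint_image (hsegc (f z))
    (hfc.comp hfc) hdisj
  obtain ⟨V, hV, hVc, hAV, hVO, hVf⟩ := (hsegp (f z)).exists_free_nhds (hsegc _) hfc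
    (hfreeSeg _ hfz) hO hAO
  obtain ⟨V', hV', hVc', hAV', hVO', hVf'⟩ := (hsegp z).exists_free_nhds (hsegc _) hfc
    (hfreeSeg _ hz) hO' hAO'
  have hxV : x ∈ V := hAV (left_mem_segment ℝ _ _)
  obtain ⟨k, rfl⟩ : ∃ k, n = k + 2 := ⟨n - 2, by omega⟩
  have hpre : IsPreconnected (f ⁻¹' V) := by
    rw [← f.image_symm]
    exact hVc.image _ f.symm.continuous.continuousOn
  obtain ⟨h, ho, hs, hb⟩ := exists_orientationPreserving_of_isPreconnected (hV.preimage hfc) hpre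
    (a := f^[k + 1] x) (b := z)
    (by rwa [mem_preimage, ← iterate_succ_apply' f, hx]) (hAV (right_mem_segment ℝ _ _))
  have hgfree : ∀ y, f.trans h y ≠ y :=
    trans_apply_ne_of_free (V := f ⁻¹' V) hfree (fun y hy hfy => hVf _ hy hfy) hs
  refine hR (k + 1) (by omega) (by omega) (f.trans h) (hor.trans ho) hgfree V' hV' hVc' ?_ x
    (hAV' (left_mem_segment ℝ _ _)) ?_
  · intro y hy
    rw [Homeomorph.trans_apply, hs _ fun hfy => hOO y (hVO' hy) (hVO hfy)]
    exact hVf' y hy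
  · rw [iterate_succ_apply', iterate_trans_eq_of_notMem hs, Homeomorph.trans_apply,
      ← iterate_succ_apply' f, hb]
    · exact hAV' (right_mem_segment ℝ _ _)
    · intro m h1 h2
      rw [mem_preimage, ← iterate_succ_apply' f]
      exact hR (m + 1) (by omega) (by omega) f hor hfree V hV hVc hVf x hxV

/-- The Brouwer theorem on periodic points together with the free disk lemma. -/
theorem noPeriod_and_noFreeReturn (n : ℕ) (hn : 1 ≤ n) : NoPeriod n ∧ NoFreeReturn n := by
  induction n using Nat.strong_induction_on with
  | _ n ih =>
    have hR : ∀ m, 1 ≤ m → m < n → NoFreeReturn m := fun m h1 h2 => (ih m h2 h1).2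
    have hP : NoPeriod n := by
      rcases (by omega : n = 1 ∨ n = 2 ∨ 3 ≤ n) with rfl | rfl | h3
      · exact fun f _ hfree x => hfree x
      · exact fun f hor hfree x => hor.no_period_two hfree x
      · exact noPeriod_of_noFreeReturn h3 hR
    exact ⟨hP, hP.noFreeReturn hn hR⟩

theorem disjoint_iterate_of_disk {f : ℂ ≃ₜ ℂ} (hor : OrientationPreserving f)
    (hfree : ∀ x, f x ≠ x) {B : Set ℂ} (e : ↥B ≃ₜ ↥(closedBall (0 : ℂ) 1))
    (hB : ∀ x ∈ interior B, f x ∉ interior B) {n : ℕ} (hn : 2 ≤ n) {x : ℂ} (hx : x ∈ B) :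
    f^[n] x ∉ B := by
  intro hy
  have hper : ∀ m, 1 ≤ m → ∀ z, f^[m] z ≠ z := fun m hm z =>
    (noPeriod_and_noFreeReturn m hm).1 f hor hfree z
  let φ : ℂ → ℂ := extend (Subtype.val : closedBall (0 : ℂ) 1 → ℂ) (fun p => (e.symm p : ℂ)) 0
  have hφ : ∀ p : closedBall (0 : ℂ) 1, φ p = e.symm p := fun p =>
    Subtype.val_injective.extend_apply _ _ p
  have hφc : ContinuousOn φ (closedBall 0 1) := by
    rw [continuousOn_iff_continuous_domRestrict]
    have : (closedBall (0 : ℂ) 1).domRestrict φ = fun p => (e.symm p : ℂ) := funext hφ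
    rw [this]
    fun_prop
  have hφi : InjOn φ (closedBall 0 1) := by
    intro a ha b hb hab
    have := hφ ⟨a, ha⟩ ▸ hφ ⟨b, hb⟩ ▸ hab
    simpa using e.symm.injective (Subtype.ext this)
  have hφB : ∀ p ∈ closedBall (0 : ℂ) 1, φ p ∈ B := fun p hp => by
    rw [hφ ⟨p, hp⟩]
    exact (e.symm ⟨p, hp⟩).2
  have hφe : ∀ (b : ℂ) (hb : b ∈ B), φ (e ⟨b, hb⟩) = b := fun b hb => by rw [hφ]; simp
  have hφint : ∀ p ∈ ball (0 : ℂ) 1, φ p ∈ interior B := by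
    intro p hp
    obtain ⟨r, hr, hrB⟩ := nhds_basis_closedBall.mem_iff.1 (isOpen_ball.mem_nhds hp)
    have hsub := hrB.trans ball_subset_closedBall
    refine mem_interior_iff_mem_nhds.2 (Filter.mem_of_superset
      (image_closedBall_mem_nhds hr (hφc.mono hsub) (hφi.mono hsub)) ?_)
    rintro _ ⟨q, hq, rfl⟩
    exact hφB q (hsub hq)
  have hBcl : B ⊆ closure (interior B) := by
    intro b hb
    have h1 : (e ⟨b, hb⟩ : ℂ) ∈ closure (ball (0 : ℂ) 1) := by
      rw [closure_ball _ one_ne_zero]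
      exact (e ⟨b, hb⟩).2
    have h2 := ((hφc _ (e ⟨b, hb⟩).2).mono ball_subset_closedBall).mem_closure h1 hφint
    rwa [hφe] at h2
  obtain ⟨hcl₁, hcl₂⟩ := free_closure isOpen_interior hB
  set y := f^[n] x with hydef
  set p : ℂ := (e ⟨x, hx⟩ : ℂ) with hp
  set q : ℂ := (e ⟨y, hy⟩ : ℂ) with hq
  have hpb : p ∈ closedBall (0 : ℂ) 1 := (e ⟨x, hx⟩).2
  have hqb : q ∈ closedBall (0 : ℂ) 1 := (e ⟨y, hy⟩).2
  have hpq : p ≠ q := by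
    intro h
    have h1 : x = y := by rw [← hφe x hx, ← hφe y hy, ← hp, ← hq, h]
    exact hper n (by omega) x h1.symm
  have hseg : segment ℝ p q ⊆ closedBall 0 1 := (convex_closedBall 0 1).segment_subset hpb hqb
  let A : Set ℂ := φ '' segment ℝ p q
  have hA : ∀ a ∈ A, a = x ∨ a = y ∨ a ∈ interior B := by
    rintro _ ⟨s, hs, rfl⟩
    rw [← insert_endpoints_openSegment] at hs
    rcases hs with rfl | rfl | hs
    · exact Or.inl (hφe x hx)
    · exact Or.inr (Or.inl (hφe y hy))
    · refine Or.inr (Or.inr (hφint s ?_))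
      rw [← interior_closedBall (0 : ℂ) one_ne_zero]
      exact (strictConvex_closedBall ℝ (0 : ℂ) 1).openSegment_subset hpb hqb hpq hs
  have hAB : A ⊆ B := by
    rintro _ ⟨s, hs, rfl⟩
    exact hφB s (hseg hs)
  have hAfree : ∀ a ∈ A, f a ∉ A := by
    intro a ha hfa
    by_cases haI : a ∈ interior B
    · exact hcl₁ a haI (hBcl (hAB hfa))
    by_cases hfaI : f a ∈ interior B
    · exact hcl₂ a (hBcl (hAB ha)) hfaI
    have ha' : a = x ∨ a = y := by simpa [haI] using hA a ha
    have hfa' : f a = x ∨ f a = y := by simpa [hfaI] using hA _ hfa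
    obtain ⟨m, rfl⟩ : ∃ m, n = m + 1 := ⟨n - 1, by omega⟩
    rcases ha' with rfl | rfl <;> rcases hfa' with h | h
    · exact hfree _ h
    · rw [hydef, iterate_succ_apply] at h
      exact hper m (by omega) _ h.symm
    · rw [hydef, ← iterate_succ_apply' f] at h
      exact hper _ (by omega) _ h
    · exact hfree _ h
  have hsegc : IsCompact (segment ℝ p q) := by
    rw [segment_eq_image_lineMap]
    exact isCompact_Icc.image (by fun_prop)
  obtain ⟨V, hV, hVc, hAV, -, hVf⟩ := ((convex_segment p q).isPreconnected.image φ
    (hφc.mono hseg)).exists_free_nhds (hsegc.image_of_continuousOn (hφc.mono hseg)) f.continuous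
    hAfree isOpen_univ (subset_univ _)
  refine (noPeriod_and_noFreeReturn n (by omega)).2 f hor hfree V hV hVc hVf x
    (hAV ⟨p, left_mem_segment ℝ _ _, hφe x hx⟩) (hAV ⟨q, right_mem_segment ℝ _ _, hφe y hy⟩)

/-- A critical disk `B` for a Brouwer homeomorphism (a topological closed disk whose interior
is free but which meets its image) meets its iterate `f^n(B)` exactly when `n ∈ {-1,0,1}`. -/
theorem stmt_3 (f : ℂ ≃ₜ ℂ) (hor : OrientationPreserving f)
    (hfree : ∀ x : ℂ, f x ≠ x)
    (B : Set ℂ) (hB : Nonempty (↥B ≃ₜ ↥(Metric.closedBall (0 : ℂ) 1)))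
    (hintfree : f '' interior B ∩ interior B = ∅)
    (hcrit : (f '' B ∩ B).Nonempty) :
    ∀ n : ℤ, ((f.toEquiv ^ n) '' B ∩ B).Nonempty ↔ (n = -1 ∨ n = 0 ∨ n = 1) := by
  obtain ⟨e⟩ := hB
  have hI : ∀ x ∈ interior B, f x ∉ interior B := fun x hx hfx =>
    (hintfree ▸ ⟨mem_image_of_mem f hx, hfx⟩ : f x ∈ (∅ : Set ℂ))
  have hsymm : ∀ n : ℤ, ((f.toEquiv ^ n) '' B ∩ B).Nonempty →
      ((f.toEquiv ^ (-n)) '' B ∩ B).Nonempty := by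
    rintro n ⟨_, ⟨x, hx, rfl⟩, hy⟩
    exact ⟨x, ⟨_, hy, by rw [zpow_neg]; exact Equiv.symm_apply_apply _ _⟩, hx⟩
  have hnat : ∀ n : ℕ, ((f.toEquiv ^ (n : ℤ)) '' B ∩ B).Nonempty → n < 2 := by
    rintro n ⟨_, ⟨x, hx, rfl⟩, hy⟩
    by_contra! hn
    rw [zpow_natCast, Equiv.Perm.coe_pow] at hy
    exact disjoint_iterate_of_disk hor hfree e hI hn hx hy
  have h1 : ((f.toEquiv ^ (1 : ℤ)) '' B ∩ B).Nonempty := by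
    rw [zpow_one]
    exact hcrit
  intro n
  constructor
  · intro h
    obtain ⟨k, rfl | rfl⟩ := n.eq_nat_or_neg
    · have := hnat k h
      omega
    · have := hnat k (by simpa using hsymm _ h)
      omega
  · rintro (rfl | rfl | rfl)
    · exact hsymm 1 h1
    · obtain ⟨_, -, hb⟩ := hcrit
      exact ⟨_, ⟨_, hb, by simp⟩, hb⟩
    · exact h1
end

section
/- Every Brouwer homeomorphism has proper orbits: if f is a fixed point free, orientation preserving homeomorphism of ℝ², then for every x ∈ ℝ² and every compact set K ⊆ ℝ², the set {n ∈ ℤ : f^n(x) ∈ K} is finite. -/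
open Set Topology

/-- A nonvanishing continuous function on a convex set has a continuous logarithm. -/
theorem exists_continuousOn_exp_eq {E : Type*} [NormedAddCommGroup E] [NormedSpace ℝ E]
    {S : Set E} (hS : Convex ℝ S) {g : E → ℂ} (hg : ContinuousOn g S)
    (h0 : ∀ x ∈ S, g x ≠ 0) :
    ∃ L : E → ℂ, ContinuousOn L S ∧ ∀ x ∈ S, Complex.exp (L x) = g x := by
  rcases S.eq_empty_or_nonempty with rfl | ⟨a, ha⟩
  · exact ⟨0, by simp, by simp⟩
  have hmem (p : unitInterval × S) : (1 - (p.1 : ℝ)) • a + (p.1 : ℝ) • (p.2 : E) ∈ S :=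
    hS ha p.2.2 (by linarith [p.1.2.2]) p.1.2.1 (by ring)
  let H : C(unitInterval × S, {z : ℂ // z ≠ 0}) :=
    ⟨fun p ↦ ⟨g ((1 - (p.1 : ℝ)) • a + (p.1 : ℝ) • (p.2 : E)), h0 _ (hmem p)⟩, by
      refine Continuous.subtype_mk (hg.comp_continuous ?_ hmem) _
      fun_prop⟩
  have hH0 (x : S) : H (0, x) = ⟨Complex.exp (Complex.log (g a)), Complex.exp_ne_zero _⟩ := by
    ext; simp [H, Complex.exp_log (h0 a ha)]
  let G := Complex.isCoveringMap_exp.liftHomotopy H (.const S (Complex.log (g a))) hH0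
  have hG (x : S) : Complex.exp (G (1, x)) = g x := by
    have := congrArg Subtype.val
      (congrFun (Complex.isCoveringMap_exp.liftHomotopy_lifts H
        (.const S (Complex.log (g a))) hH0) (1, x))
    simpa [H] using this
  classical
  refine ⟨fun x ↦ if hx : x ∈ S then G (1, ⟨x, hx⟩) else 0, ?_, fun x hx ↦ ?_⟩
  · rw [continuousOn_iff_continuous_domRestrict]
    have : Continuous fun x : S ↦ G (1, x) := by fun_prop
    exact this.congr fun x ↦ by simp
  · simpa [hx] using hG ⟨x, hx⟩

theorem IsPreconnected.eq_of_exp_eq {X : Type*} [TopologicalSpace X] {S : Set X}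
    (hS : IsPreconnected S) {D : X → ℂ} (hD : ContinuousOn D S) {c : ℂ}
    (hc : ∀ x ∈ S, Complex.exp (D x) = c) {x y : X} (hx : x ∈ S) (hy : y ∈ S) : D x = D y := by
  have : PreconnectedSpace S := isPreconnected_iff_preconnectedSpace.mp hS
  have h := Complex.isCoveringMap_exp.eq_of_comp_eq (A := S) (g₁ := fun z ↦ D z)
    (g₂ := fun _ ↦ D y) (continuousOn_iff_continuous_domRestrict.mp hD) continuous_const
    (by ext z; simp [hc z z.2, hc y hy]) ⟨y, hy⟩ rfl
  exact congrFun h ⟨x, hx⟩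

/-- The line spanned by a translation arc of a fixed point free map isotopic to the identity
contains no simple loop: the angle of a chord would be multivalued. -/
theorem no_simple_loop_of_translation_arc {F : ℝ → ℂ ≃ₜ ℂ}
    (hF : Continuous fun p : ℝ × ℂ ↦ F p.1 p.2) (hF0 : F 0 = Homeomorph.refl ℂ)
    (hfree : ∀ z, F 1 z ≠ z) {γ : ℝ → ℂ} (hγ : Continuous γ)
    (hstep : ∀ u, γ (u + 1) = F 1 (γ u))
    (hne : ∀ u v, u < v → v ≤ u + 1 → γ u ≠ γ v)
    {T : ℝ} (hT : 1 < T) (hloop : γ T = γ 0)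
    (hsimple : ∀ u v, 0 ≤ u → u < v → v ≤ T → γ u = γ v → u = 0 ∧ v = T) : False := by
  have hcont {S : Set ((ℝ × ℝ) × ℝ)} :
      ContinuousOn (fun p : (ℝ × ℝ) × ℝ ↦ F p.2 (γ p.1.2) - F p.2 (γ p.1.1)) S := by
    have h1 : Continuous fun p : (ℝ × ℝ) × ℝ ↦ F p.2 (γ p.1.2) :=
      hF.comp (continuous_snd.prodMk (hγ.comp (by fun_prop)))
    have h2 : Continuous fun p : (ℝ × ℝ) × ℝ ↦ F p.2 (γ p.1.1) :=
      hF.comp (continuous_snd.prodMk (hγ.comp (by fun_prop)))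
    exact (h1.sub h2).continuousOn
  -- the strip and the triangle with a vertex removed
  let P : Set (ℝ × ℝ) := {p | p.1 < p.2 ∧ p.2 ≤ p.1 + 1}
  let Q : Set (ℝ × ℝ) := {p | 0 ≤ p.1 ∧ p.1 < p.2 ∧ p.2 ≤ T ∧ p.2 - p.1 < T}
  have hP : Convex ℝ P := by
    rintro ⟨a, b⟩ ⟨h1, h2⟩ ⟨c, d⟩ ⟨h3, h4⟩ s t hs ht hst
    simp only [P, mem_ofPred_eq, Prod.fst_add, Prod.snd_add, Prod.smul_fst, Prod.smul_snd,
      smul_eq_mul] at *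
    constructor
    · rcases hs.eq_or_lt with rfl | hs
      · obtain rfl : t = 1 := by linarith
        linarith
      · nlinarith
    · nlinarith
  have hQ : Convex ℝ Q := by
    rintro ⟨a, b⟩ ⟨h1, h2, h3, h4⟩ ⟨c, d⟩ ⟨h5, h6, h7, h8⟩ s t hs ht hst
    simp only [Q, mem_ofPred_eq, Prod.fst_add, Prod.snd_add, Prod.smul_fst, Prod.smul_snd,
      smul_eq_mul] at *
    obtain rfl : t = 1 - s := by linarith
    refine ⟨by positivity, ?_, by nlinarith, ?_⟩
    · rcases hs.eq_or_lt with rfl | hs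
      · linarith
      · nlinarith
    · rcases hs.eq_or_lt with rfl | hs
      · linarith
      · nlinarith
  obtain ⟨M, hM, hMexp⟩ := exists_continuousOn_exp_eq (hP.prod convex_univ) hcont
    (fun p hp ↦ sub_ne_zero.mpr fun h ↦
      hne p.1.1 p.1.2 hp.1.1 hp.1.2 ((F p.2).injective h).symm)
  obtain ⟨N, hN, hNexp⟩ := exists_continuousOn_exp_eq (hQ.prod convex_univ) hcont
    (fun p hp ↦ sub_ne_zero.mpr fun h ↦ by
      obtain ⟨⟨h1, h2, h3, h4⟩, -⟩ := hp
      obtain ⟨h5, h6⟩ := hsimple p.1.1 p.1.2 h1 h2 h3 ((F p.2).injective h).symm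
      rw [h5, h6] at h4
      linarith)
  obtain ⟨L, hL, hLexp⟩ := exists_continuousOn_exp_eq (S := (univ : Set ℂ))
    (g := fun z ↦ F 1 z - z) convex_univ (by fun_prop) (fun z _ ↦ sub_ne_zero.mpr (hfree z))
  simp only [mem_prod, mem_univ, and_true] at hMexp hNexp
  have hF0' (z : ℂ) : F 0 z = z := by simp [hF0]
  -- applying `F 1` changes the lifts like a unit translation, up to constants
  have c1 {p q : ℝ × ℝ} (hp : p ∈ P) (hq : q ∈ P) :
      M (p, 1) - M ((p.1 + 1, p.2 + 1), 0) = M (q, 1) - M ((q.1 + 1, q.2 + 1), 0) := by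
    have hsh {p : ℝ × ℝ} (hp : p ∈ P) : (p.1 + 1, p.2 + 1) ∈ P :=
      ⟨by linarith [hp.1], by linarith [hp.2]⟩
    refine hP.isPreconnected.eq_of_exp_eq (c := 1)
      (D := fun p ↦ M (p, 1) - M ((p.1 + 1, p.2 + 1), 0)) ?_ ?_ hp hq
    · refine (hM.comp (by fun_prop) fun p hp ↦ ⟨hp, trivial⟩).sub
        (hM.comp (by fun_prop) fun p hp ↦ ⟨hsh hp, trivial⟩)
    · intro p hp
      rw [Complex.exp_sub, hMexp (p, 1) hp, hMexp (_, 0) (hsh hp)]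
      simp only [hF0', hstep]
      exact div_self (sub_ne_zero.mpr fun h ↦ hne _ _ hp.1 hp.2 ((F 1).injective h).symm)
  have c2 {p q : ℝ × ℝ} (hp : p ∈ Q) (hp' : p.2 + 1 ≤ T) (hq : q ∈ Q) (hq' : q.2 + 1 ≤ T) :
      N (p, 1) - N ((p.1 + 1, p.2 + 1), 0) = N (q, 1) - N ((q.1 + 1, q.2 + 1), 0) := by
    have hsh {p : ℝ × ℝ} (hp : p ∈ Q ∩ {p | p.2 ≤ T - 1}) : (p.1 + 1, p.2 + 1) ∈ Q := by
      obtain ⟨⟨h1, h2, h3, h4⟩, h5⟩ := hp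
      simp only [mem_ofPred_eq] at h5
      refine ⟨?_, ?_, ?_, ?_⟩ <;> dsimp only <;> linarith
    have hconv : Convex ℝ (Q ∩ {p | p.2 ≤ T - 1}) :=
      hQ.inter (convex_halfSpace_le (LinearMap.snd ℝ ℝ ℝ).isLinear _)
    refine hconv.isPreconnected.eq_of_exp_eq (c := 1)
      (D := fun p ↦ N (p, 1) - N ((p.1 + 1, p.2 + 1), 0)) ?_ ?_
      ⟨hp, le_sub_iff_add_le.mpr hp'⟩ ⟨hq, le_sub_iff_add_le.mpr hq'⟩
    · refine (hN.comp (by fun_prop) fun p hp ↦ ⟨hp.1, trivial⟩).sub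
        (hN.comp (by fun_prop) fun p hp ↦ ⟨hsh hp, trivial⟩)
    · intro p hp
      have h0 := Complex.exp_ne_zero (N (p, 1))
      rw [Complex.exp_sub, hNexp (_, 0) (hsh hp)]
      rw [hNexp (p, 1) hp.1] at h0 ⊢
      simp only [hF0', hstep]
      exact div_self h0
  have c3 {x y : (ℝ × ℝ) × ℝ} (hx : x.1 ∈ P ∩ Q) (hy : y.1 ∈ P ∩ Q) :
      M x - N x = M y - N y := by
    refine ((hP.inter hQ).prod convex_univ).isPreconnected.eq_of_exp_eq (c := 1)
      (D := fun p ↦ M p - N p) ?_ ?_ ⟨hx, mem_univ x.2⟩ ⟨hy, mem_univ y.2⟩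
    · exact (hM.mono (prod_mono inter_subset_left subset_rfl)).sub
        (hN.mono (prod_mono inter_subset_right subset_rfl))
    · intro p hp
      have h0 := Complex.exp_ne_zero (N p)
      rw [Complex.exp_sub, hMexp p hp.1.1]
      rw [hNexp p hp.1.2] at h0 ⊢
      exact div_self h0
  have hvert {v : ℝ} (hv : v ∈ Ioo 0 T) : (v, T) ∈ Q ∧ ((0 : ℝ), v) ∈ Q := by
    obtain ⟨h1, h2⟩ := hv
    refine ⟨⟨?_, ?_, ?_, ?_⟩, ?_, ?_, ?_, ?_⟩ <;> dsimp only <;> linarith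
  have e4 {v : ℝ} (hv : v ∈ Ioo 0 T) : Complex.exp (N ((v, T), 0) - N ((0, v), 0)) = -1 := by
    have h0 := Complex.exp_ne_zero (N ((0, v), 0))
    rw [Complex.exp_sub, hNexp ((v, T), 0) (hvert hv).1]
    rw [hNexp ((0, v), 0) (hvert hv).2] at h0 ⊢
    simp only [hF0', hloop] at h0 ⊢
    rw [div_eq_iff h0]
    ring
  have c4 {v w : ℝ} (hv : v ∈ Ioo 0 T) (hw : w ∈ Ioo 0 T) :
      N ((v, T), 0) - N ((0, v), 0) = N ((w, T), 0) - N ((0, w), 0) := by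
    refine (convex_Ioo (0 : ℝ) T).isPreconnected.eq_of_exp_eq (c := -1)
      (D := fun v ↦ N ((v, T), 0) - N ((0, v), 0)) ?_ (fun v hv ↦ e4 hv) hv hw
    exact (hN.comp (by fun_prop) fun v hv ↦ ⟨(hvert hv).1, trivial⟩).sub
      (hN.comp (by fun_prop) fun v hv ↦ ⟨(hvert hv).2, trivial⟩)
  have hunit (u : ℝ) : (u, u + 1) ∈ P := ⟨by simp, le_rfl⟩
  have c5 : M ((T, T + 1), 0) = M ((0, 0 + 1), 0) := by
    have := isPreconnected_univ.eq_of_exp_eq (c := 1) (x := T) (y := 0)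
      (D := fun u : ℝ ↦ M ((u, u + 1), 0) - L (γ u))
      ((hM.comp (by fun_prop) fun u _ ↦ ⟨hunit u, trivial⟩).sub
        (hL.comp hγ.continuousOn fun _ _ ↦ trivial))
      (fun u _ ↦ by
        rw [Complex.exp_sub, hMexp (_, 0) (hunit u), hLexp _ trivial]
        simp only [hF0', hstep]
        exact div_self (sub_ne_zero.mpr (hfree _))) trivial trivial
    simpa [hloop] using this
  have hprev : (T - 1, T) ∈ P := by simpa using hunit (T - 1)
  have hT1 : T - 1 ∈ Ioo 0 T := ⟨by linarith, by linarith⟩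
  have h1T : (1 : ℝ) ∈ Ioo 0 T := ⟨one_pos, hT⟩
  have c6 : N ((0, T - 1), 1) - M ((T - 1, T), 1) = N ((0, T - 1), 0) - M ((T - 1, T), 0) := by
    refine isPreconnected_univ.eq_of_exp_eq (c := -1) (x := (1 : ℝ)) (y := 0)
      (D := fun t : ℝ ↦ N ((0, T - 1), t) - M ((T - 1, T), t))
      ((hN.comp (by fun_prop) fun _ _ ↦ ⟨(hvert hT1).2, trivial⟩).sub
        (hM.comp (by fun_prop) fun _ _ ↦ ⟨hprev, trivial⟩)) (fun t _ ↦ ?_) trivial trivial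
    have h0 := Complex.exp_ne_zero (M ((T - 1, T), t))
    rw [Complex.exp_sub, hNexp (_, t) (hvert hT1).2]
    rw [hMexp (_, t) hprev] at h0 ⊢
    simp only [hloop] at h0 ⊢
    rw [div_eq_iff h0]
    ring
  -- a common point of the strip and the triangle
  obtain ⟨m, hm0, hm1, hmT⟩ : ∃ m : ℝ, 0 < m ∧ m ≤ 1 ∧ m ≤ T - 1 :=
    ⟨min 1 (T - 1), by simp [hT], min_le_left _ _, min_le_right _ _⟩
  have hmP : ((0 : ℝ), m) ∈ P := ⟨hm0, by simpa using hm1⟩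
  have hmQ : ((0 : ℝ), m) ∈ Q := (hvert ⟨hm0, by linarith⟩).2
  have hmP' : ((0 : ℝ) + 1, m + 1) ∈ P := ⟨by simpa using hm0, by dsimp only; linarith⟩
  have hmQ' : ((0 : ℝ) + 1, m + 1) ∈ Q := by
    refine ⟨?_, ?_, ?_, ?_⟩ <;> dsimp only <;> linarith
  have k1 := c1 hmP hprev
  have k2 := c2 (p := (0, m)) (q := (0, T - 1)) hmQ (by dsimp only; linarith) (hvert hT1).2
    (by dsimp only; linarith)
  have k3 := c3 (x := ((0, m), 1)) (y := ((0, 0 + 1), 0)) ⟨hmP, hmQ⟩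
    ⟨hunit 0, by simpa using (hvert h1T).2⟩
  have k7 := c3 (x := ((0 + 1, m + 1), 0)) (y := ((0, 0 + 1), 0)) ⟨hmP', hmQ'⟩
    ⟨hunit 0, by simpa using (hvert h1T).2⟩
  have k6 := c3 (x := ((T - 1, T), 0)) (y := ((0, 0 + 1), 0)) ⟨hprev, (hvert hT1).1⟩
    ⟨hunit 0, by simpa using (hvert h1T).2⟩
  have k4 := c4 hT1 h1T
  have k5 := e4 h1T
  simp only [zero_add, sub_add_cancel] at *
  have key : N ((1, T), 0) - N ((0, 1), 0) = 0 := by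
    linear_combination (1 / 2 : ℂ) * (-k1 + k2 + k3 - k7 + c6 + c5 - k4 - k6)
  rw [key, Complex.exp_zero] at k5
  norm_num at k5

/-- The line spanned by a translation arc of a fixed point free map isotopic to the identity
is injective. -/
theorem eq_of_translation_arc {F : ℝ → ℂ ≃ₜ ℂ}
    (hF : Continuous fun p : ℝ × ℂ ↦ F p.1 p.2) (hF0 : F 0 = Homeomorph.refl ℂ)
    (hfree : ∀ z, F 1 z ≠ z) {γ : ℝ → ℂ} (hγ : Continuous γ)
    (hstep : ∀ u (n : ℤ), γ (u + n) = ((F 1).toEquiv ^ n) (γ u))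
    (hne : ∀ u v, u < v → v ≤ u + 1 → γ u ≠ γ v) {a b : ℝ} (hab : γ a = γ b) : a = b := by
  by_contra hne'
  wlog hlt : a < b generalizing a b
  · exact this hab.symm (Ne.symm hne') (lt_of_le_of_ne (not_lt.mp hlt) (Ne.symm hne'))
  have hshift {u v : ℝ} (h : γ u = γ v) : γ (u - ⌊u⌋) = γ (v - ⌊u⌋) := by
    have h1 := hstep u (-⌊u⌋)
    have h2 := hstep v (-⌊u⌋)
    push_cast at h1 h2
    rw [sub_eq_add_neg, sub_eq_add_neg, h1, h2, h]
  have hgap {u v : ℝ} (huv : u < v) (h : γ u = γ v) : u + 1 < v :=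
    not_le.mp fun h' ↦ hne u v huv h' h
  let K : Set (ℝ × ℝ) :=
    (Icc 0 1 ×ˢ Icc 1 (1 + (b - a))) ∩ {p | p.1 + 1 ≤ p.2 ∧ γ p.1 = γ p.2}
  have hK : IsCompact K := by
    refine (isCompact_Icc.prod isCompact_Icc).inter_right ?_
    have hle : IsClosed {p : ℝ × ℝ | p.1 + 1 ≤ p.2} := isClosed_le (by fun_prop) (by fun_prop)
    have heq : IsClosed {p : ℝ × ℝ | γ p.1 = γ p.2} := isClosed_eq (by fun_prop) (by fun_prop)
    exact hle.inter heq
  have hmem {u v : ℝ} (huv : u < v) (hle : v - u ≤ b - a) (h : γ u = γ v) :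
      (u - ⌊u⌋, v - ⌊u⌋) ∈ K := by
    have h0 := Int.floor_le u
    have h1 := Int.lt_floor_add_one u
    have h2 := hgap huv h
    refine ⟨⟨⟨?_, ?_⟩, ?_, ?_⟩, ?_, hshift h⟩ <;> dsimp only <;> linarith
  obtain ⟨⟨s, t⟩, ⟨⟨-, -⟩, hst, hs⟩, hmin⟩ := hK.exists_isMinOn ⟨_, hmem hlt le_rfl hab⟩
    (f := fun p : ℝ × ℝ ↦ p.2 - p.1) (by fun_prop)
  have hmin' {u v : ℝ} (huv : u < v) (h : γ u = γ v) : t - s ≤ v - u := by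
    have hle {u v : ℝ} (huv : u < v) (hle : v - u ≤ b - a) (h : γ u = γ v) : t - s ≤ v - u := by
      have : t - s ≤ v - ⌊u⌋ - (u - ⌊u⌋) := hmin (hmem huv hle h)
      linarith
    rcases le_total (v - u) (b - a) with h' | h'
    · exact hle huv h' h
    · exact (hle hlt le_rfl hab).trans h'
  dsimp only at hst hs
  refine no_simple_loop_of_translation_arc hF hF0 hfree (γ := fun u ↦ γ (u + s)) (by fun_prop)
    (fun u ↦ ?_) (fun u v h1 h2 ↦ hne _ _ (by linarith) (by linarith)) (T := t - s) ?_ ?_ ?_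
  · simpa [add_right_comm] using hstep (u + s) 1
  · linarith [hgap (by linarith) hs]
  · simpa using hs.symm
  · intro u v h0 h1 h2 h
    have := hmin' (by linarith) h
    constructor <;> linarith

theorem Homeomorph.continuous_toEquiv_zpow {X : Type*} [TopologicalSpace X] (f : X ≃ₜ X) (n : ℤ) :
    Continuous (f.toEquiv ^ n : Equiv.Perm X) := by
  induction n with
  | zero => exact continuous_id
  | succ n ih =>
    rw [zpow_add_one]
    exact ih.comp f.continuous
  | pred n ih =>
    rw [zpow_sub_one]
    exact ih.comp f.symm.continuous

theorem Homeomorph.exists_continuous_extension_of_translation_arc {X : Type*} [TopologicalSpace X]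
    (f : X ≃ₜ X) {p : ℝ → X} (hp : Continuous p) (h01 : p 1 = f (p 0)) :
    ∃ γ : ℝ → X, Continuous γ ∧ (∀ u ∈ Icc (0 : ℝ) 1, γ u = p u) ∧
      ∀ u (n : ℤ), γ (u + n) = (f.toEquiv ^ n) (γ u) := by
  let γ (u : ℝ) : X := (f.toEquiv ^ ⌊u⌋) (p (Int.fract u))
  have hstep (u : ℝ) (n : ℤ) : γ (u + n) = (f.toEquiv ^ n) (γ u) := by
    simp only [γ, Int.floor_add_intCast, Int.fract_add_intCast]
    rw [add_comm, zpow_add, Equiv.Perm.mul_apply]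
  have hγp : ∀ u ∈ Icc (0 : ℝ) 1, γ u = p u := by
    rintro u ⟨h0, h1⟩
    rcases h1.eq_or_lt with rfl | h1
    · simp [γ, h01]
    · simp [γ, Int.floor_eq_zero_iff.mpr ⟨h0, h1⟩, Int.fract_eq_self.mpr ⟨h0, h1⟩]
  refine ⟨γ, ?_, hγp, hstep⟩
  have hlf : LocallyFinite fun n : ℤ ↦ Icc (n : ℝ) (n + 1) :=
    locallyFinite_Icc_of_tendsto (tendsto_intCast_atTop_atTop) (by
      simpa using Filter.tendsto_atBot_add_const_right _ (1 : ℝ)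
        (tendsto_intCast_atBot_iff.mpr Filter.tendsto_id))
  refine hlf.continuous (eq_univ_of_forall fun u ↦ mem_iUnion.mpr
    ⟨⌊u⌋, Int.floor_le u, (Int.lt_floor_add_one u).le⟩) (fun _ ↦ isClosed_Icc) fun n ↦ ?_
  have : Continuous fun u : ℝ ↦ (f.toEquiv ^ n) (p (u - n)) :=
    (f.continuous_toEquiv_zpow n).comp (by fun_prop)
  refine this.continuousOn.congr fun u hu ↦ ?_
  dsimp only
  rw [← hγp (u - n) ⟨by linarith [hu.1], by linarith [hu.2]⟩, ← hstep, sub_add_cancel]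

/-- A ball disjoint from its image can be enlarged until a boundary point is mapped to a
boundary point. -/
theorem Homeomorph.exists_maximal_free_ball {f : ℂ ≃ₜ ℂ} {c : ℂ} {ρ : ℝ}
    (hfree : ∀ w ∈ Metric.ball c ρ, f w ∉ Metric.ball c ρ) :
    ∃ r, ρ ≤ r ∧ (∀ w ∈ Metric.ball c r, f w ∉ Metric.ball c r) ∧
      ∃ y, dist y c = r ∧ dist (f y) c = r := by
  have hf := f.continuous
  let m (w : ℂ) : ℝ := max (dist w c) (dist (f w) c)
  have hm : Continuous m := by fun_prop
  obtain ⟨y, hy⟩ := hm.exists_forall_le (Filter.tendsto_atTop_mono (fun w ↦ le_max_left _ _)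
    (tendsto_dist_right_cocompact_atTop c))
  have hmin {w : ℂ} (h : dist w c < m y) : m y ≤ dist (f w) c := by
    rcases le_max_iff.mp (hy w) with h' | h'
    · exact absurd h' (not_le.mpr h)
    · exact h'
  have hsphere {w : ℂ} {V : Set ℂ} (hV : IsOpen V) (hw : w ∈ V) (hwr : dist w c ≤ m y)
      (hr : 0 < m y) : ∃ w' ∈ V, dist w' c < m y := by
    have : w ∈ closure (Metric.ball c (m y)) := by
      rw [closure_ball c hr.ne']
      exact hwr
    obtain ⟨w', h1, h2⟩ := mem_closure_iff.mp this V hV hw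
    exact ⟨w', h1, h2⟩
  refine ⟨m y, ?_, fun w hw h ↦ (hmin hw).not_gt h, y, ?_⟩
  · by_contra! h
    exact hfree y ((le_max_left _ _).trans_lt h) ((le_max_right _ _).trans_lt h)
  have h1 : m y ≤ dist (f y) c := by
    by_contra! h
    obtain ⟨w, hw, hwr⟩ := hsphere (V := {w | dist (f w) c < m y})
      (isOpen_lt (by fun_prop) (by fun_prop)) h (le_max_left _ _) (dist_nonneg.trans_lt h)
    exact (hmin hwr).not_gt hw
  have h2 : m y ≤ dist y c := by
    by_contra! h
    have hf' := f.symm.continuous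
    obtain ⟨w, hw, hwr⟩ := hsphere (w := f y) (V := {w | dist (f.symm w) c < m y})
      (isOpen_lt (by fun_prop) (by fun_prop)) (by simpa using h) (le_max_right _ _)
      (dist_nonneg.trans_lt h)
    have := hmin hw
    rw [f.apply_symm_apply] at this
    exact this.not_gt hwr
  exact ⟨le_antisymm (le_max_left _ _) h2, le_antisymm (le_max_right _ _) h1⟩

/-- Two boundary points of a disc are joined by an arc inside the disc passing through the
centre and any other prescribed interior point. -/
theorem exists_arc_through {c y y' z : ℂ} {r : ℝ} (hr : 0 < r) (hy : dist y c = r)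
    (hy' : dist y' c = r) (hne : y ≠ y') (hz : z ∈ Metric.ball c r) :
    ∃ p : ℝ → ℂ, Continuous p ∧ p 0 = y ∧ p 1 = y' ∧ InjOn p (Icc 0 1) ∧
      (∀ u ∈ Ioo (0 : ℝ) 1, p u ∈ Metric.ball c r) ∧
      ∃ s ∈ Ioo (0 : ℝ) 1, ∃ t ∈ Ioo (0 : ℝ) 1, p s = c ∧ p t = z := by
  rw [Metric.mem_ball, Complex.dist_eq] at hz
  rw [Complex.dist_eq] at hy hy'
  have hyc : y - c ≠ 0 := norm_pos_iff.mp (hy ▸ hr)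
  obtain ⟨t, ht0, ht1, ht⟩ : ∃ t : ℝ, 0 < t ∧ t ≤ 1 / 2 ∧ ‖z - c‖ = (1 - 2 * t) * r := by
    refine ⟨(1 - ‖z - c‖ / r) / 2, ?_, ?_, ?_⟩
    · have := (div_lt_one hr).mpr hz
      linarith
    · have : 0 ≤ ‖z - c‖ / r := by positivity
      linarith
    · field_simp
      ring
  let k : ℝ := Complex.arg ((z - c) / (y - c)) / (2 * t)
  let e (u : ℝ) : ℂ := Complex.exp ((k * (1 - |1 - 2 * u|) : ℝ) * Complex.I)
  let q (u : ℝ) : ℂ := (max (1 - 2 * u) 0 : ℝ) * (y - c) + (max (2 * u - 1) 0 : ℝ) * (y' - c)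
  have he (u : ℝ) : ‖e u‖ = 1 := Complex.norm_exp_ofReal_mul_I _
  have hq (u : ℝ) : ‖q u‖ = |1 - 2 * u| * r := by
    rcases le_total u (1 / 2) with h | h
    · have h1 : 0 ≤ 1 - 2 * u := by linarith
      have h2 : 2 * u - 1 ≤ 0 := by linarith
      simp only [q, max_eq_left h1, max_eq_right h2, Complex.ofReal_zero, zero_mul, add_zero,
        norm_mul, hy, Complex.norm_real, Real.norm_eq_abs]
    · have h1 : 1 - 2 * u ≤ 0 := by linarith
      have h2 : 0 ≤ 2 * u - 1 := by linarith
      simp only [q, max_eq_right h1, max_eq_left h2, Complex.ofReal_zero, zero_mul, zero_add,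
        norm_mul, hy', Complex.norm_real, Real.norm_eq_abs, abs_sub_comm]
  have hnorm (u : ℝ) : ‖c + e u * q u - c‖ = |1 - 2 * u| * r := by
    rw [add_sub_cancel_left, norm_mul, he, hq, one_mul]
  refine ⟨fun u ↦ c + e u * q u, by fun_prop, by simp [e, q], by simp [e, q]; norm_num, ?_, ?_,
    1 / 2, by norm_num, t, ⟨ht0, by linarith⟩, by simp [q], ?_⟩
  · intro u hu v hv huv
    dsimp only at huv
    have habs : |1 - 2 * u| = |1 - 2 * v| := by
      have := hnorm u
      rw [huv, hnorm v] at this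
      exact (mul_right_cancel₀ hr.ne' this).symm
    have hqq : q u = q v := by
      have : e u = e v := by simp only [e, habs]
      rw [this] at huv
      exact mul_left_cancel₀ (Complex.exp_ne_zero _) (add_left_cancel huv)
    rcases abs_eq_abs.mp habs with h | h
    · linarith
    by_contra huv'
    wlog hlt : u < v generalizing u v
    · exact this hv hu huv.symm habs.symm hqq.symm (by linarith) (Ne.symm huv')
        (lt_of_le_of_ne (not_lt.mp hlt) (Ne.symm huv'))
    have h1 : 0 < 1 - 2 * u := by linarith
    have h2 : 2 * u - 1 ≤ 0 := by linarith
    have h3 : 1 - 2 * v ≤ 0 := by linarith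
    have h4 : 2 * v - 1 = 1 - 2 * u := by linarith
    simp only [q, max_eq_left h1.le, max_eq_right h2, max_eq_right h3, h4, Complex.ofReal_zero,
      zero_mul, add_zero, zero_add] at hqq
    exact hne (sub_left_injective (mul_left_cancel₀ (Complex.ofReal_ne_zero.mpr h1.ne') hqq))
  · rintro u ⟨h0, h1⟩
    rw [Metric.mem_ball, Complex.dist_eq, hnorm]
    have : |1 - 2 * u| < 1 := abs_lt.mpr ⟨by linarith, by linarith⟩
    nlinarith
  · have h1 : 0 ≤ 1 - 2 * t := by linarith
    have h2 : 2 * t - 1 ≤ 0 := by linarith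
    have h3 : k * (1 - |1 - 2 * t|) = Complex.arg ((z - c) / (y - c)) := by
      rw [abs_of_nonneg h1]
      simp only [k]
      field_simp
      ring
    have h4 : ((1 - 2 * t : ℝ) : ℂ) = ‖(z - c) / (y - c)‖ := by
      rw [norm_div, hy, ht, mul_div_cancel_right₀ _ hr.ne']
    simp only [q, e, max_eq_left h1, max_eq_right h2, h3, Complex.ofReal_zero, zero_mul, add_zero]
    rw [h4, ← mul_assoc, mul_comm (Complex.exp _), Complex.norm_mul_exp_arg_mul_I,
      div_mul_cancel₀ _ hyc, add_sub_cancel]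

/-- The orbit of the centre of a ball disjoint from its image never returns to the ball. -/
theorem zpow_apply_notMem_ball {f : ℂ ≃ₜ ℂ} (hor : OrientationPreserving f)
    (hfix : ∀ x, f x ≠ x) {c : ℂ} {ρ : ℝ} (hfree : ∀ w ∈ Metric.ball c ρ, f w ∉ Metric.ball c ρ)
    {n : ℤ} (hn : n ≠ 0) : (f.toEquiv ^ n) c ∉ Metric.ball c ρ := by
  intro hz
  obtain ⟨F, hF, hF0, rfl⟩ := hor
  obtain ⟨r, hρr, hfree, y, hy, hy'⟩ := Homeomorph.exists_maximal_free_ball hfree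
  replace hz := Metric.ball_subset_ball hρr hz
  obtain ⟨p, hp, hp0, hp1, hinj, hball, s, hs, t, ht, hsc, htz⟩ :=
    exists_arc_through (Metric.pos_of_mem_ball hz) hy hy' (hfix y).symm hz
  obtain ⟨γ, hγ, hγp, hstep⟩ :=
    (F 1).exists_continuous_extension_of_translation_arc hp (by rw [hp0, hp1])
  have hmem {u : ℝ} (hu : u ∈ Ioo (0 : ℝ) 1) : γ u ∈ Metric.ball c r := by
    rw [hγp u (Ioo_subset_Icc_self hu)]
    exact hball u hu
  have hγinj : InjOn γ (Icc 0 1) := hinj.congr fun u hu ↦ (hγp u hu).symm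
  have hstep1 (u : ℝ) : γ (u + 1) = F 1 (γ u) := by simpa using hstep u 1
  have hne₀ {u v : ℝ} (hu : u ∈ Ico (0 : ℝ) 1) (huv : u < v) (hv : v ≤ u + 1) : γ u ≠ γ v := by
    obtain ⟨h0, h1⟩ := hu
    intro h
    rcases le_or_gt v 1 with hv1 | hv1
    · exact huv.ne (hγinj ⟨h0, h1.le⟩ ⟨h0.trans huv.le, hv1⟩ h)
    · have hu' : u ∈ Ioo (0 : ℝ) 1 := ⟨by linarith, h1⟩
      have hv' := hstep1 (v - 1)
      rw [sub_add_cancel, ← h] at hv'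
      exact hfree _ (hmem ⟨by linarith, by linarith⟩) (hv' ▸ hmem hu')
  have hne (u v : ℝ) (huv : u < v) (hv : v ≤ u + 1) : γ u ≠ γ v := by
    intro h
    have h1 := hstep u (-⌊u⌋)
    have h2 := hstep v (-⌊u⌋)
    push_cast at h1 h2
    refine hne₀ (u := u + -⌊u⌋) (v := v + -⌊u⌋) ⟨?_, ?_⟩ (by linarith) (by linarith) ?_
    · linarith [Int.floor_le u]
    · linarith [Int.lt_floor_add_one u]
    · rw [h1, h2, h]
  have heq : t = s + n := by
    refine eq_of_translation_arc hF hF0 hfix hγ hstep hne ?_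
    rw [hstep, hγp t (Ioo_subset_Icc_self ht), hγp s (Ioo_subset_Icc_self hs), hsc, htz]
  have h1 : (n : ℝ) < 1 := by linarith [hs.1, ht.2]
  have h2 : (-1 : ℝ) < n := by linarith [hs.2, ht.1]
  have h1' : n < 1 := by exact_mod_cast h1
  have h2' : -1 < n := by exact_mod_cast h2
  omega

/-- Every Brouwer homeomorphism has proper orbits: every orbit meets a compact set
only finitely many times. -/
theorem stmt_5 (f : ℂ ≃ₜ ℂ) (hor : OrientationPreserving f)
    (hfree : ∀ x : ℂ, f x ≠ x) :
    ∀ (x : ℂ) (K : Set ℂ), IsCompact K → {n : ℤ | (f.toEquiv ^ n) x ∈ K}.Finite := by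
  intro x K hK
  by_contra hinf
  have hwander (y : ℂ) : ∃ U ∈ 𝓝 y, {n : ℤ | (f.toEquiv ^ n) x ∈ U}.Subsingleton := by
    obtain ⟨V, W, hV, hW, hyV, hyW, hVW⟩ := t2_separation (hfree y)
    obtain ⟨δ, hδ, hball⟩ := Metric.isOpen_iff.mp (hW.inter (hV.preimage f.continuous)) y
      ⟨hyW, hyV⟩
    refine ⟨Metric.ball y (δ / 3), Metric.ball_mem_nhds y (by positivity), fun n hn m hm ↦ ?_⟩
    by_contra hnm
    simp only [mem_ofPred_eq, Metric.mem_ball] at hn hm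
    have hsub : Metric.ball ((f.toEquiv ^ n) x) (2 * δ / 3) ⊆ Metric.ball y δ :=
      Metric.ball_subset_ball' (by linarith)
    refine zpow_apply_notMem_ball hor hfree (c := (f.toEquiv ^ n) x) (ρ := 2 * δ / 3) (n := m - n)
      (fun w hw hfw ↦ ?_) (sub_ne_zero.mpr (Ne.symm hnm)) ?_
    · exact hVW.ne_of_mem (hball (hsub hw)).2 (hball (hsub hfw)).1 rfl
    · rw [← Equiv.Perm.mul_apply, ← zpow_add, sub_add_cancel, Metric.mem_ball]
      linarith [dist_triangle_right ((f.toEquiv ^ m) x) ((f.toEquiv ^ n) x) y]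
  choose U hU hsub using hwander
  obtain ⟨T, -, hT⟩ := hK.elim_nhds_subcover U fun y _ ↦ hU y
  refine hinf ((T.finite_toSet.biUnion fun y _ ↦ (hsub y).finite).subset fun n hn ↦ ?_)
  obtain ⟨y, hy, hny⟩ := mem_iUnion₂.mp (hT hn)
  exact mem_iUnion₂.mpr ⟨y, hy, hny⟩
end
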